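/- For every nonnegative integer n, ∫_0^∞ x^{2n}/cosh(πx/2) dx = a_n, where a_n are the secant numbers defined by 1/cos(x) = ∑_{n≥0} a_n x^{2n}/(2n)!, i.e. the Euler numbers (−1)^n E_n, a sequence beginning 1, 1, 5, 61, …. -/

import Mathlib

open Real Nat MeasureTheory

lemma integrableOn_beta_integrand {u v : ℝ} (hu : 0 < u) (hv : 0 < v) :
    IntegrableOn (fun x : ℝ => x ^ (u - 1) * (1 - x) ^ (v - 1)) (Set.Ioo 0 1) ∧
      ∫ x in Set.Ioo (0 : ℝ) 1, x ^ (u - 1) * (1 - x) ^ (v - 1) =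
        Real.Gamma u * Real.Gamma v / Real.Gamma (u + v) := by
  have hcast : Set.EqOn (fun x : ℝ => (x : ℂ) ^ ((u : ℂ) - 1) * (1 - (x : ℂ)) ^ ((v : ℂ) - 1))
      (fun x : ℝ => ((x ^ (u - 1) * (1 - x) ^ (v - 1) : ℝ) : ℂ)) (Set.Ioo 0 1) := by
    intro x hx
    have hx' : (0 : ℝ) ≤ 1 - x := by linarith [hx.2]
    simp only [Complex.ofReal_mul, Complex.ofReal_cpow hx.1.le, Complex.ofReal_cpow hx',
      Complex.ofReal_sub, Complex.ofReal_one]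
  constructor
  · have h := Complex.betaIntegral_convergent (u := u) (v := v) (by simpa) (by simpa)
    rw [intervalIntegrable_iff_integrableOn_Ioo_of_le zero_le_one] at h
    have h2 := ((integrableOn_congr_fun hcast measurableSet_Ioo).1 h).re
    simpa [IntegrableOn] using h2
  · have h := ProbabilityTheory.beta_eq_betaIntegralReal u v hu hv
    rw [Complex.betaIntegral, intervalIntegral.integral_of_le zero_le_one,
      integral_Ioc_eq_integral_Ioo, setIntegral_congr_fun measurableSet_Ioo hcast,
      integral_complex_ofReal, Complex.ofReal_re] at h
    exact h.symm

lemma sigmoid_eq_exp_div_cosh (x : ℝ) : sigmoid x = exp (x / 2) / (2 * cosh (x / 2)) := by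
  have h : exp (x / 2) * exp (-x) = exp (-(x / 2)) := by
    rw [← exp_add]; ring_nf
  rw [sigmoid_def, cosh_eq, inv_eq_one_div, div_eq_div_iff (by positivity) (by positivity)]
  linear_combination -h

lemma sigmoid_rpow_mul_one_sub_sigmoid_rpow (x p : ℝ) :
    sigmoid x ^ (1 / 2 + p) * (1 - sigmoid x) ^ (1 / 2 - p) =
      exp (p * x) / (2 * cosh (x / 2)) := by
  have hc : 0 < 2 * cosh (x / 2) := by positivity
  rw [← sigmoid_neg, sigmoid_eq_exp_div_cosh, sigmoid_eq_exp_div_cosh, neg_div, cosh_neg,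
    div_rpow (exp_pos _).le hc.le, div_rpow (exp_pos _).le hc.le, _root_.div_mul_div_comm,
    ← rpow_add hc, ← exp_mul, ← exp_mul, ← exp_add]
  ring_nf
  simp only [rpow_one, mul_inv]
  ring

lemma integrable_exp_div_cosh {t : ℝ} (ht : |t| < π / 2) :
    Integrable (fun x : ℝ => exp (t * x) / (2 * cosh (π * x / 2))) ∧
      ∫ x : ℝ, exp (t * x) / (2 * cosh (π * x / 2)) = 1 / cos t := by
  obtain ⟨h1, h2⟩ := abs_lt.1 ht
  have hpi := pi_pos
  have hu : 0 < 1 / 2 + t / π := by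
    have : 0 < (π / 2 + t) / π := div_pos (by linarith) hpi
    convert this using 1; field_simp
  have hv : 0 < 1 / 2 - t / π := by
    have : 0 < (π / 2 - t) / π := div_pos (by linarith) hpi
    convert this using 1; field_simp
  have himg : (fun x => sigmoid (π * x)) '' Set.univ = Set.Ioo 0 1 := by
    rw [Set.image_univ, ← range_sigmoid]
    exact (mul_left_surjective₀ hpi.ne').range_comp sigmoid
  have hderiv : ∀ x ∈ Set.univ, HasDerivWithinAt (fun x => sigmoid (π * x))
      (sigmoid (π * x) * (1 - sigmoid (π * x)) * π) Set.univ x := fun x _ =>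
    ((hasDerivAt_sigmoid (π * x)).comp x
      (by simpa using (hasDerivAt_id x).const_mul π)).hasDerivWithinAt
  have hinj : Set.InjOn (fun x => sigmoid (π * x)) Set.univ := fun x _ y _ h =>
    mul_left_cancel₀ hpi.ne' (sigmoid_injective h)
  have hfun : ∀ x : ℝ, |sigmoid (π * x) * (1 - sigmoid (π * x)) * π| •
      (sigmoid (π * x) ^ (1 / 2 + t / π - 1) * (1 - sigmoid (π * x)) ^ (1 / 2 - t / π - 1)) =
      π * (exp (t * x) / (2 * cosh (π * x / 2))) := by
    intro x
    have ha := sigmoid_pos (π * x)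
    have hb : 0 < 1 - sigmoid (π * x) := by linarith [sigmoid_lt_one (π * x)]
    have h := sigmoid_rpow_mul_one_sub_sigmoid_rpow (π * x) (t / π)
    rw [show t / π * (π * x) = t * x by field_simp] at h
    rw [abs_of_pos (by positivity), ← h, rpow_sub_one ha.ne', rpow_sub_one hb.ne', smul_eq_mul]
    field_simp
  obtain ⟨hI, hE⟩ := integrableOn_beta_integrand hu hv
  rw [← himg, integrableOn_image_iff_integrableOn_abs_deriv_smul MeasurableSet.univ hderiv hinj,
    integrableOn_univ] at hI
  rw [← himg, integral_image_eq_integral_abs_deriv_smul MeasurableSet.univ hderiv hinj,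
    setIntegral_univ] at hE
  simp only [hfun] at hI hE
  constructor
  · exact (integrable_const_mul_iff (isUnit_iff_ne_zero.2 hpi.ne') _).1 hI
  · rw [integral_const_mul, show 1 / 2 - t / π = 1 - (1 / 2 + t / π) by ring,
      Gamma_mul_Gamma_one_sub, show 1 / 2 + t / π + (1 - (1 / 2 + t / π)) = 1 by ring, Gamma_one,
      show π * (1 / 2 + t / π) = t + π / 2 by field_simp; ring, sin_add_pi_div_two, div_one,
      div_eq_mul_one_div π] at hE
    exact mul_left_cancel₀ hpi.ne' hE

lemma integrable_cosh_div_cosh {t : ℝ} (ht : |t| < π / 2) :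
    Integrable (fun x : ℝ => cosh (t * x) / cosh (π * x / 2)) ∧
      ∫ x in Set.Ioi (0 : ℝ), cosh (t * x) / cosh (π * x / 2) = 1 / cos t := by
  obtain ⟨h1, e1⟩ := integrable_exp_div_cosh ht
  obtain ⟨h2, e2⟩ := integrable_exp_div_cosh (t := -t) (by rwa [abs_neg])
  have hfun : (fun x : ℝ => cosh (t * x) / cosh (π * x / 2)) = fun x =>
      exp (t * x) / (2 * cosh (π * x / 2)) + exp (-t * x) / (2 * cosh (π * x / 2)) := by
    funext x
    rw [cosh_eq (t * x), neg_mul]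
    have := cosh_pos (π * x / 2)
    field_simp
  refine ⟨hfun ▸ h1.add h2, ?_⟩
  have h := integral_comp_abs (f := fun x : ℝ => cosh (t * x) / cosh (π * x / 2))
  have habs : (fun x : ℝ => cosh (t * |x|) / cosh (π * |x| / 2)) =
      fun x => cosh (t * x) / cosh (π * x / 2) := by
    funext x
    rcases abs_choice x with hx | hx <;> simp [hx, neg_div]
  rw [habs] at h
  have h' : ∫ x : ℝ, cosh (t * x) / cosh (π * x / 2) = 1 / cos t + 1 / cos t := by
    rw [hfun, integral_add h1 h2, e1, e2, cos_neg]
  linarith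

lemma hasSum_sech_moments {t : ℝ} (ht : |t| < π / 2) :
    HasSum (fun n : ℕ => (∫ x in Set.Ioi (0 : ℝ), x ^ (2 * n) / cosh (π * x / 2)) *
      t ^ (2 * n) / ((2 * n)! : ℝ)) (1 / cos t) := by
  obtain ⟨hI, hE⟩ := integrable_cosh_div_cosh ht
  have hsum : ∀ x : ℝ, HasSum (fun n : ℕ => t ^ (2 * n) / ((2 * n)! : ℝ) *
      (x ^ (2 * n) / cosh (π * x / 2))) (cosh (t * x) / cosh (π * x / 2)) := by
    intro x
    refine ((hasSum_cosh (t * x)).div_const (cosh (π * x / 2))).congr_fun fun n => ?_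
    rw [mul_pow]; ring
  have h := hasSum_integral_of_dominated_convergence (μ := volume.restrict (Set.Ioi (0 : ℝ)))
    (F := fun n x => t ^ (2 * n) / ((2 * n)! : ℝ) * (x ^ (2 * n) / cosh (π * x / 2)))
    (fun n x => t ^ (2 * n) / ((2 * n)! : ℝ) * (x ^ (2 * n) / cosh (π * x / 2)))
    (fun n => by
      refine Continuous.aestronglyMeasurable ?_
      fun_prop (disch := exact fun x => (cosh_pos _).ne'))
    (fun n => .of_forall fun x => by
      have := (even_two_mul n).pow_nonneg t
      have := (even_two_mul n).pow_nonneg x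
      exact (norm_of_nonneg (by positivity)).le)
    (.of_forall fun x => (hsum x).summable)
    (by simpa only [(hsum _).tsum_eq] using hI.restrict)
    (.of_forall hsum)
  rw [hE] at h
  refine h.congr_fun fun n => ?_
  rw [integral_const_mul]
  ring

lemma eq_of_hasSum_even_powers {b c : ℕ → ℝ} {f : ℝ → ℝ} {r : ℝ} (hr : 0 < r)
    (hb : ∀ x : ℝ, |x| < r → HasSum (fun n => b n * x ^ (2 * n)) (f x))
    (hc : ∀ x : ℝ, |x| < r → HasSum (fun n => c n * x ^ (2 * n)) (f x)) : b = c := by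
  have key : ∀ d : ℕ → ℝ, (∀ x : ℝ, |x| < r → HasSum (fun n => d n * x ^ (2 * n)) (f x)) →
      HasFPowerSeriesAt f (FormalMultilinearSeries.ofScalars ℝ
        fun k => if Even k then d (k / 2) else 0) 0 := by
    intro d hd
    rw [hasFPowerSeriesAt_iff]
    filter_upwards [Metric.ball_mem_nhds (0 : ℝ) hr] with x hx
    have hinj : Function.Injective fun n : ℕ => 2 * n := fun m n h => by simpa using h
    rw [zero_add, ← hinj.hasSum_iff]
    · refine (hd x (by simpa using hx)).congr_fun fun n => ?_
      simp [mul_comm]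
    · intro k hk
      have : ¬ Even k := fun ⟨m, hm⟩ => hk ⟨m, (two_mul m).trans hm.symm⟩
      simp [this]
  have h := (key b hb).eq_formalMultilinearSeries (key c hc)
  funext n
  have := congrArg (fun p => FormalMultilinearSeries.coeff p (2 * n)) h
  simpa using this

/-- moment formula for the hyperbolic secant:
∫_0^∞ x^{2n} sech(πx/2) dx = a_n, the n-th secant number. -/
theorem stmt4 (a : ℕ → ℝ)
    (ha : ∀ x : ℝ, |x| < 1 → HasSum (fun n => a n * x ^ (2*n) / ((2*n)! : ℝ)) (1 / Real.cos x))
    (n : ℕ) :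
    (∫ x in Set.Ioi (0:ℝ), x ^ (2*n) / Real.cosh (Real.pi * x / 2)) = a n := by
  have h := eq_of_hasSum_even_powers (f := fun x => 1 / cos x)
    (b := fun n => (∫ x in Set.Ioi (0 : ℝ), x ^ (2 * n) / cosh (π * x / 2)) / ((2 * n)! : ℝ))
    (c := fun n => a n / ((2 * n)! : ℝ)) one_pos
    (fun x hx => by
      simpa only [mul_div_right_comm] using
        hasSum_sech_moments (hx.trans (by linarith [pi_gt_three])))
    (fun x hx => by simpa only [mul_div_right_comm] using ha x hx)
  exact (div_left_inj' (by positivity)).1 (congrFun h n)
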